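/- arXiv:2408.12845 — 5 statements merged into one kernel-verified Lean document; each statement's English description precedes it below -/
import Mathlib

section
/- Let N ≥ 1, let w : Fin N → ℝ be strictly decreasing (i ≤ j with i ≠ j implies w j < w i) with w i > 0 for all i, and let U, U' : Fin N → ℝ be utility vectors such that there exists an index i with U i > U' i and U j = U' j for all j ≠ i. Then G_w(U') < G_w(U). -/
open Finset Matrix

/-- The weighted Gini social-evaluation function: `G_w(U) = ∑ i, w i * Φ_i(U)`,
where `Φ_i(U)` is the `(i+1)`-th smallest entry of `U`. -/
noncomputable def gini {N : ℕ} (w U : Fin N → ℝ) : ℝ :=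
  ∑ i, w i * U (Tuple.sort U i)

/-- For antitone weights, sorting the utilities increasingly minimises the weighted sum
(rearrangement inequality). -/
theorem gini_le_sum_mul_comp_perm {N : ℕ} {w : Fin N → ℝ} (hw : Antitone w) (U : Fin N → ℝ)
    (σ : Equiv.Perm (Fin N)) : gini w U ≤ ∑ i, w i * U (σ i) := by
  simpa [gini] using (hw.antivary (Tuple.monotone_sort U)).sum_mul_le_sum_mul_comp_perm
    (σ := σ.trans (Tuple.sort U).symm)

theorem stmt_0 (N : ℕ) (hN : 1 ≤ N) (w : Fin N → ℝ)
    (hw_strict : ∀ i j : Fin N, i ≤ j → i ≠ j → w j < w i)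
    (hw_pos : ∀ i, 0 < w i)
    (U U' : Fin N → ℝ) (i : Fin N)
    (hi : U i > U' i) (hagree : ∀ j, j ≠ i → U j = U' j) :
    gini w U' < gini w U := by
  have hw : Antitone w := fun a b hab => by
    rcases eq_or_ne a b with rfl | hne
    · exact le_rfl
    · exact (hw_strict a b hab hne).le
  refine (gini_le_sum_mul_comp_perm hw U' (Tuple.sort U)).trans_lt ?_
  have hle : U' ≤ U := fun j => by
    rcases eq_or_ne j i with rfl | hj
    · exact hi.le
    · exact (hagree j hj).ge
  refine Finset.sum_lt_sum
    (fun j _ => mul_le_mul_of_nonneg_left (hle (Tuple.sort U j)) (hw_pos j).le)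
    ⟨(Tuple.sort U).symm i, Finset.mem_univ _, ?_⟩
  rw [Equiv.apply_symm_apply]
  exact mul_lt_mul_of_pos_left hi (hw_pos _)
end

section
/- Let N ≥ 1 and let w : Fin N → ℝ be non-negative and non-increasing, and set w_max = max_{i} w i. For every pair of utility vectors U, U' : Fin N → ℝ that agree on all coordinates except possibly coordinate i, one has |G_w(U) − G_w(U')| ≤ w_max · |U i − U' i|; i.e., the weighted Gini social-evaluation function is locally Lipschitz continuous in each coordinate with constant w_max. -/
open Finset Matrix

/-- By the rearrangement inequality, for non-increasing weights the sorting permutation minimizes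
the weighted sum of utilities. -/
lemma gini_le_sum_comp_perm {N : ℕ} {w : Fin N → ℝ} (hw : Antitone w) (U : Fin N → ℝ)
    (σ : Equiv.Perm (Fin N)) : gini w U ≤ ∑ j, w j * U (σ j) := by
  have h : Antivary w (U ∘ Tuple.sort U) := hw.antivary (Tuple.monotone_sort U)
  simpa [gini] using h.sum_mul_le_sum_mul_comp_perm (σ := σ.trans (Tuple.sort U).symm)

lemma gini_sub_le {N : ℕ} {w : Fin N → ℝ} (hw_nonneg : ∀ i, 0 ≤ w i) (hw_anti : Antitone w)
    {c : ℝ} (hc : ∀ i, w i ≤ c) {U U' : Fin N → ℝ} {i : Fin N}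
    (hagree : ∀ j, j ≠ i → U j = U' j) :
    gini w U - gini w U' ≤ c * |U i - U' i| := by
  set σ := Tuple.sort U'
  calc gini w U - gini w U'
      ≤ ∑ j, w j * U (σ j) - ∑ j, w j * U' (σ j) :=
        sub_le_sub_right (gini_le_sum_comp_perm hw_anti U σ) _
    _ = ∑ j, w j * (U (σ j) - U' (σ j)) := by simp only [mul_sub, Finset.sum_sub_distrib]
    _ = w (σ.symm i) * (U i - U' i) := by
        rw [Finset.sum_eq_single (σ.symm i)]
        · simp
        · intro j _ hj
          rw [hagree (σ j) fun h => hj (by simp [← h]), sub_self, mul_zero]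
        · simp
    _ ≤ c * |U i - U' i| :=
        (mul_le_mul_of_nonneg_left (le_abs_self _) (hw_nonneg _)).trans
          (mul_le_mul_of_nonneg_right (hc _) (abs_nonneg _))

theorem stmt_2 (N : ℕ) (hN : 1 ≤ N) (w : Fin N → ℝ)
    (hw_nonneg : ∀ i, 0 ≤ w i) (hw_anti : Antitone w)
    (wmax : ℝ) (hwmax : wmax = Finset.univ.sup' ⟨⟨0, hN⟩, Finset.mem_univ _⟩ w)
    (U U' : Fin N → ℝ) (i : Fin N)
    (hagree : ∀ j, j ≠ i → U j = U' j) :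
    |gini w U - gini w U'| ≤ wmax * |U i - U' i| := by
  have hc : ∀ j, w j ≤ wmax := fun j => hwmax ▸ Finset.le_sup' w (Finset.mem_univ j)
  rw [abs_sub_le_iff]
  refine ⟨gini_sub_le hw_nonneg hw_anti hc hagree, ?_⟩
  rw [abs_sub_comm]
  exact gini_sub_le hw_nonneg hw_anti hc fun j hj => (hagree j hj).symm
end

section
/- Let N ≥ 1, let w : Fin N → ℝ be non-negative and non-increasing with w_max = max_i w i, let U : Fin N → ℝ be a vector of current cumulative utilities, let f : Fin N → ℝ be the true utilities with f n ≥ 0 for all n, and let f̂, h : Fin N → ℝ satisfy |f̂ n − f n| ≤ h n for all n. Suppose n⋆ maximizes n ↦ G_w(update U n (U n + f n)) over Fin N, and n_t maximizes the optimistic objective n ↦ G_w(update U n (U n + f̂ n + h n)) over Fin N. Then the instantaneous regret satisfies G_w(update U n⋆ (U n⋆ + f n⋆)) − G_w(update U n_t (U n_t + f n_t)) ≤ 2 · w_max · h n_t. -/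
open Finset Matrix

/-- By the rearrangement inequality, sorting minimizes the weighted sum over all permutations. -/
theorem gini_le_sum_perm {N : ℕ} {w : Fin N → ℝ} (hw : Antitone w) (V : Fin N → ℝ)
    (τ : Equiv.Perm (Fin N)) : gini w V ≤ ∑ i, w i * V (τ i) := by
  have hanti : Antivary w (V ∘ Tuple.sort V) := hw.antivary (Tuple.monotone_sort V)
  simpa [gini] using hanti.sum_mul_le_sum_mul_comp_perm (σ := τ.trans (Tuple.sort V).symm)

theorem gini_mono {N : ℕ} {w : Fin N → ℝ} (hw : Antitone w) (hw0 : ∀ i, 0 ≤ w i) :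
    Monotone (gini w) := fun V V' hV =>
  (gini_le_sum_perm hw V (Tuple.sort V')).trans <|
    Finset.sum_le_sum fun i _ => mul_le_mul_of_nonneg_left (hV _) (hw0 i)

theorem gini_update_le_add {N : ℕ} {w : Fin N → ℝ} (hw : Antitone w) {c : ℝ}
    (hc : ∀ i, w i ≤ c) (U : Fin N → ℝ) (n : Fin N) {a b : ℝ} (hab : a ≤ b) :
    gini w (Function.update U n b) ≤ gini w (Function.update U n a) + c * (b - a) := by
  set τ := Tuple.sort (Function.update U n a) with hτ
  have hsum : ∑ i, w i * Function.update U n b (τ i) =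
      gini w (Function.update U n a) + w (τ.symm n) * (b - a) := by
    rw [gini, ← hτ, ← sub_eq_iff_eq_add', ← Finset.sum_sub_distrib,
      Finset.sum_eq_single (τ.symm n)]
    · simp [mul_sub]
    · intro i _ hi
      have hne : τ i ≠ n := fun h => hi (τ.eq_symm_apply.2 h)
      simp [Function.update_of_ne hne]
    · simp
  calc gini w (Function.update U n b) ≤ _ := gini_le_sum_perm hw _ τ
    _ = _ := hsum
    _ ≤ _ := by
      gcongr
      exact hc _

theorem stmt_3 (N : ℕ) (hN : 1 ≤ N) (w : Fin N → ℝ)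
    (hw_nonneg : ∀ i, 0 ≤ w i) (hw_anti : Antitone w)
    (wmax : ℝ) (hwmax : wmax = Finset.univ.sup' ⟨⟨0, hN⟩, Finset.mem_univ _⟩ w)
    (U f fhat h : Fin N → ℝ)
    (hf : ∀ n, 0 ≤ f n)
    (hest : ∀ n, |fhat n - f n| ≤ h n)
    (nstar nt : Fin N)
    (hstar : ∀ n, gini w (Function.update U n (U n + f n)) ≤
      gini w (Function.update U nstar (U nstar + f nstar)))
    (hnt : ∀ n, gini w (Function.update U n (U n + fhat n + h n)) ≤
      gini w (Function.update U nt (U nt + fhat nt + h nt))) :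
    gini w (Function.update U nstar (U nstar + f nstar)) -
      gini w (Function.update U nt (U nt + f nt)) ≤ 2 * wmax * h nt := by
  have hmax : ∀ i, w i ≤ wmax := fun i => hwmax ▸ Finset.le_sup' w (Finset.mem_univ i)
  have hmax0 : 0 ≤ wmax := (hw_nonneg nt).trans (hmax nt)
  have hoptimism : gini w (Function.update U nstar (U nstar + f nstar)) ≤
      gini w (Function.update U nstar (U nstar + fhat nstar + h nstar)) :=
    gini_mono hw_anti hw_nonneg <| update_le_update_iff'.2 <| by
      linarith [(abs_le.1 (hest nstar)).1]
  obtain ⟨hlo, hhi⟩ := abs_le.1 (hest nt)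
  have hlip := gini_update_le_add hw_anti hmax U nt
    (a := U nt + f nt) (b := U nt + fhat nt + h nt) (by linarith)
  have hwidth : wmax * (U nt + fhat nt + h nt - (U nt + f nt)) ≤ wmax * (2 * h nt) :=
    mul_le_mul_of_nonneg_left (by linarith) hmax0
  linarith [hnt nstar]
end

section
/- Let N ≥ 1 and let G : (Fin N → ℝ) → ℝ be a goodness function that is (i) locally monotonically non-decreasing: for every vector U, index i, and real u ≥ 0, G(update U i (U i + u)) ≥ G(U); and (ii) locally Lipschitz continuous: there are constants c : Fin N → ℝ with c i ≥ 0 such that for every U, index i, and reals a, b, |G(update U i a) − G(update U i b)| ≤ c i · |a − b|. Let U : Fin N → ℝ, let f : Fin N → ℝ be true utilities with f n ≥ 0 for all n, and let f̂, h : Fin N → ℝ satisfy |f̂ n − f n| ≤ h n for all n. If n⋆ maximizes n ↦ G(update U n (U n + f n)) and n_t maximizes n ↦ G(update U n (U n + f̂ n + h n)), then G(update U n⋆ (U n⋆ + f n⋆)) − G(update U n_t (U n_t + f n_t)) ≤ 2 · c n_t · h n_t. -/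
open Finset Matrix

theorem stmt_5 (N : ℕ) (hN : 1 ≤ N) (G : (Fin N → ℝ) → ℝ)
    (hmono : ∀ (U : Fin N → ℝ) (i : Fin N) (u : ℝ), 0 ≤ u →
      G (Function.update U i (U i + u)) ≥ G U)
    (c : Fin N → ℝ) (hc : ∀ i, 0 ≤ c i)
    (hlip : ∀ (U : Fin N → ℝ) (i : Fin N) (a b : ℝ),
      |G (Function.update U i a) - G (Function.update U i b)| ≤ c i * |a - b|)
    (U f fhat h : Fin N → ℝ)
    (hf : ∀ n, 0 ≤ f n)
    (hest : ∀ n, |fhat n - f n| ≤ h n)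
    (nstar nt : Fin N)
    (hstar : ∀ n, G (Function.update U n (U n + f n)) ≤
      G (Function.update U nstar (U nstar + f nstar)))
    (hnt : ∀ n, G (Function.update U n (U n + fhat n + h n)) ≤
      G (Function.update U nt (U nt + fhat nt + h nt))) :
    G (Function.update U nstar (U nstar + f nstar)) -
      G (Function.update U nt (U nt + f nt)) ≤ 2 * c nt * h nt := by
  have optimism : G (Function.update U nstar (U nstar + f nstar)) ≤
      G (Function.update U nstar (U nstar + fhat nstar + h nstar)) := by
    have hm := hmono (Function.update U nstar (U nstar + f nstar)) nstar
      (fhat nstar + h nstar - f nstar) (by linarith [(abs_le.mp (hest nstar)).1])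
    rw [Function.update_self, Function.update_idem,
      show U nstar + f nstar + (fhat nstar + h nstar - f nstar) =
        U nstar + fhat nstar + h nstar by ring] at hm
    exact hm
  have width : |U nt + fhat nt + h nt - (U nt + f nt)| ≤ 2 * h nt := by
    have := abs_le.mp (hest nt)
    exact abs_le.mpr ⟨by linarith, by linarith⟩
  calc G (Function.update U nstar (U nstar + f nstar)) - G (Function.update U nt (U nt + f nt))
      ≤ G (Function.update U nt (U nt + fhat nt + h nt)) -
          G (Function.update U nt (U nt + f nt)) :=
        sub_le_sub_right (optimism.trans (hnt nstar)) _
    _ ≤ c nt * |U nt + fhat nt + h nt - (U nt + f nt)| :=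
        (le_abs_self _).trans (hlip U nt _ _)
    _ ≤ c nt * (2 * h nt) := mul_le_mul_of_nonneg_left width (hc nt)
    _ = 2 * c nt * h nt := by ring
end

section
/- Let N ≥ 1, T ≥ 1, and let G : (Fin N → ℝ) → ℝ be a goodness function that is (i) locally monotonically non-decreasing: for every vector U, index i, and real u ≥ 0, G(update U i (U i + u)) ≥ G(U); and (ii) locally Lipschitz continuous: there are constants c : Fin N → ℝ with c i ≥ 0 such that for every U, index i, and reals a, b, |G(update U i a) − G(update U i b)| ≤ c i · |a − b|; set c_max = max_i c i. For each round t ∈ Fin T, let U_t : Fin N → ℝ, let f_t : Fin N → ℝ satisfy f_t n ≥ 0 for all n, and let f̂_t, h_t : Fin N → ℝ satisfy |f̂_t n − f_t n| ≤ h_t n for all n; suppose n_t maximizes n ↦ G(update U_t n (U_t n + f̂_t n + h_t n)) and n⋆_t maximizes n ↦ G(update U_t n (U_t n + f_t n)). Then ∑_{t=0}^{T−1} [ G(update U_t n⋆_t (U_t n⋆_t + f_t n⋆_t)) − G(update U_t n_t (U_t n_t + f_t n_t)) ] ≤ 2 · c_max · √T · √( ∑_{t=0}^{T−1} ( h_t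 n_t )² ). -/
open Finset Matrix

theorem stmt_6 (N T : ℕ) (hN : 1 ≤ N) (hT : 1 ≤ T) (G : (Fin N → ℝ) → ℝ)
    (hmono : ∀ (U : Fin N → ℝ) (i : Fin N) (u : ℝ), 0 ≤ u →
      G (Function.update U i (U i + u)) ≥ G U)
    (c : Fin N → ℝ) (hc : ∀ i, 0 ≤ c i)
    (hlip : ∀ (U : Fin N → ℝ) (i : Fin N) (a b : ℝ),
      |G (Function.update U i a) - G (Function.update U i b)| ≤ c i * |a - b|)
    (cmax : ℝ) (hcmax : cmax = Finset.univ.sup' ⟨⟨0, hN⟩, Finset.mem_univ _⟩ c)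
    (U f fhat h : Fin T → Fin N → ℝ)
    (hf : ∀ t n, 0 ≤ f t n)
    (hest : ∀ t n, |fhat t n - f t n| ≤ h t n)
    (nt nstar : Fin T → Fin N)
    (hnt : ∀ t n, G (Function.update (U t) n (U t n + fhat t n + h t n)) ≤
      G (Function.update (U t) (nt t) (U t (nt t) + fhat t (nt t) + h t (nt t))))
    (hstar : ∀ t n, G (Function.update (U t) n (U t n + f t n)) ≤
      G (Function.update (U t) (nstar t) (U t (nstar t) + f t (nstar t)))) :
    ∑ t, (G (Function.update (U t) (nstar t) (U t (nstar t) + f t (nstar t))) -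
        G (Function.update (U t) (nt t) (U t (nt t) + f t (nt t)))) ≤
      2 * cmax * Real.sqrt T * Real.sqrt (∑ t, (h t (nt t)) ^ 2) := by
  have hcle : ∀ i, c i ≤ cmax := fun i => hcmax ▸ Finset.le_sup' c (Finset.mem_univ i)
  have hcmax0 : 0 ≤ cmax := (hc ⟨0, hN⟩).trans (hcle _)
  have hstep : ∀ t, G (Function.update (U t) (nstar t) (U t (nstar t) + f t (nstar t))) -
      G (Function.update (U t) (nt t) (U t (nt t) + f t (nt t))) ≤
      2 * cmax * h t (nt t) := by
    intro t
    have hs := abs_le.1 (hest t (nstar t))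
    have hn := abs_le.1 (hest t (nt t))
    have hoptimistic := hmono
      (Function.update (U t) (nstar t) (U t (nstar t) + f t (nstar t))) (nstar t)
      (fhat t (nstar t) + h t (nstar t) - f t (nstar t)) (by linarith)
    rw [Function.update_idem, Function.update_self,
      show U t (nstar t) + f t (nstar t) + (fhat t (nstar t) + h t (nstar t) - f t (nstar t)) =
        U t (nstar t) + fhat t (nstar t) + h t (nstar t) by ring] at hoptimistic
    have hdiff := (le_abs_self _).trans (hlip (U t) (nt t)
      (U t (nt t) + fhat t (nt t) + h t (nt t)) (U t (nt t) + f t (nt t)))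
    have hwidth : |U t (nt t) + fhat t (nt t) + h t (nt t) - (U t (nt t) + f t (nt t))| ≤
        2 * h t (nt t) := abs_le.2 ⟨by linarith, by linarith⟩
    have hbound := mul_le_mul (hcle (nt t)) hwidth (abs_nonneg _) hcmax0
    linarith [hnt t (nstar t)]
  have hcs : ∑ t, h t (nt t) ≤ Real.sqrt T * Real.sqrt (∑ t, (h t (nt t)) ^ 2) := by
    rw [← Real.sqrt_mul (Nat.cast_nonneg T)]
    apply Real.le_sqrt_of_sq_le
    simpa using sq_sum_le_card_mul_sum_sq (s := Finset.univ) (f := fun t => h t (nt t))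
  calc _ ≤ ∑ t, 2 * cmax * h t (nt t) := Finset.sum_le_sum fun t _ => hstep t
    _ = 2 * cmax * ∑ t, h t (nt t) := (Finset.mul_sum _ _ _).symm
    _ ≤ 2 * cmax * (Real.sqrt T * Real.sqrt (∑ t, (h t (nt t)) ^ 2)) := by gcongr
    _ = _ := by ring
end
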